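/- arXiv:math/0206077 — 2 statements merged into one kernel-verified Lean document; each statement's English description precedes it below -/
import Mathlib

section
/- For every u, v ∈ S_n, all shortest directed paths from u to v in the quantum Bruhat graph Γ_n (i.e., all directed paths from u to v whose length is minimal among directed paths from u to v) have the same weight. -/
open Equiv

/-- Number of inversions of a permutation of `Fin n` (its Coxeter length). -/
def len (n : ℕ) (w : Equiv.Perm (Fin n)) : ℕ :=
  (Finset.univ.filter (fun p : Fin n × Fin n => p.1 < p.2 ∧ w p.2 < w p.1)).card

/-- The endpoint of the edge labeled `p = (i, j)` starting at `u`: right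
multiplication by the transposition `s_{ij}`. -/
def step (n : ℕ) (u : Equiv.Perm (Fin n)) (p : Fin n × Fin n) : Equiv.Perm (Fin n) :=
  u * Equiv.swap p.1 p.2

/-- `u → u·s_{ij}` is an edge of the quantum Bruhat graph `Γ_n`:
either `ℓ(u s_{ij}) = ℓ(u) + 1`, or `ℓ(u s_{ij}) = ℓ(u) + 1 - 2(j - i)`. -/
def isQBEdge (n : ℕ) (u : Equiv.Perm (Fin n)) (p : Fin n × Fin n) : Prop :=
  p.1 < p.2 ∧
    (len n (step n u p) = len n u + 1 ∨
     len n (step n u p) + 2 * ((p.2 : ℕ) - (p.1 : ℕ)) = len n u + 1)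

/-- The weight in `ℤ^{n-1}` of the edge labeled `p = (i,j)` starting at `u`:
`0` for a Bruhat cover, and `e_i + e_{i+1} + ⋯ + e_{j-1}` for a quantum edge.
(Here coordinates of `Fin (n-1)` are `0`-based: index `k` is the paper's `q_{k+1}`.) -/
def edgeWeight (n : ℕ) (u : Equiv.Perm (Fin n)) (p : Fin n × Fin n) : Fin (n - 1) → ℤ :=
  if len n (step n u p) = len n u + 1 then 0
  else fun k => if (p.1 : ℕ) ≤ (k : ℕ) ∧ (k : ℕ) < (p.2 : ℕ) then 1 else 0

/-- `isPath n u L v` : the list of labels `L` encodes a directed path from `u` to `v`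
in the quantum Bruhat graph `Γ_n`. -/
def isPath (n : ℕ) : Equiv.Perm (Fin n) → List (Fin n × Fin n) → Equiv.Perm (Fin n) → Prop
  | u, [], v => u = v
  | u, p :: ps, v => isQBEdge n u p ∧ isPath n (step n u p) ps v

/-- The weight of a directed path: the sum in `ℤ^{n-1}` of the weights of its edges. -/
def pathWeight (n : ℕ) : Equiv.Perm (Fin n) → List (Fin n × Fin n) → (Fin (n - 1) → ℤ)
  | _, [] => 0
  | u, p :: ps => edgeWeight n u p + pathWeight n (step n u p) ps

/-- Every edge of the path is length-increasing (a Bruhat cover). -/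
def allUp (n : ℕ) : Equiv.Perm (Fin n) → List (Fin n × Fin n) → Prop
  | _, [] => True
  | u, p :: ps => len n (step n u p) = len n u + 1 ∧ allUp n (step n u p) ps

/-- A path with labels `(a_1,b_1), …, (a_i,b_i)` is `y_k^i`-admissible if
`a_1 ≤ ⋯ ≤ a_i ≤ k < b_1, …, b_i` and the `b_t` are pairwise distinct.
(`k : Fin (n-1)` is `0`-based: it stands for the paper's `k+1`.) -/
def yAdm (n : ℕ) (k : Fin (n - 1)) (L : List (Fin n × Fin n)) : Prop :=
  List.Chain' (· ≤ ·) (L.map Prod.fst) ∧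
  (∀ p ∈ L, (p.1 : ℕ) ≤ (k : ℕ) ∧ (k : ℕ) < (p.2 : ℕ)) ∧
  (L.map Prod.snd).Nodup

/-- A path is `y^β`-admissible if it is a concatenation `P_1 ∘ ⋯ ∘ P_{n-1}` where
`P_k` is `y_k^{β_k}`-admissible. -/
def yBetaAdm (n : ℕ) (β : Fin (n - 1) → ℕ) (L : List (Fin n × Fin n)) : Prop :=
  ∃ Ls : Fin (n - 1) → List (Fin n × Fin n),
    L = (List.ofFn Ls).flatten ∧
    ∀ k : Fin (n - 1), (Ls k).length = β k ∧ yAdm n k (Ls k)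

/-- A path with labels `(a_1,b_1), …, (a_l,b_l)` is admissible if there are
`k_1 ≤ ⋯ ≤ k_l` with `a_t ≤ k_t < b_t` and the pairs `(k_t, b_t)` pairwise distinct. -/
def Adm (n : ℕ) (L : List (Fin n × Fin n)) : Prop :=
  ∃ ks : List ℕ, ks.length = L.length ∧ List.Chain' (· ≤ ·) ks ∧
    (∀ pr ∈ ks.zip L, (pr.2.1 : ℕ) ≤ pr.1 ∧ pr.1 < (pr.2.2 : ℕ)) ∧
    (ks.zip (L.map Prod.snd)).Nodup

/-- The longest permutation `w_o : i ↦ n + 1 - i` (0-based: `i ↦ n - 1 - i`). -/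
def wo (n : ℕ) : Equiv.Perm (Fin n) :=
  Function.Involutive.toPerm Fin.rev (fun i => Fin.rev_rev i)
/-- The number of positions `m ≤ k` with `a ≤ w m`. -/
def cornerCount {n : ℕ} (w : Equiv.Perm (Fin n)) (k a : ℕ) : ℤ :=
  ∑ m : Fin n, if (m : ℕ) ≤ k ∧ a ≤ (w m : ℕ) then 1 else 0

lemma cornerCount_eq_zero {n : ℕ} (w : Equiv.Perm (Fin n)) (k : ℕ) : cornerCount w k n = 0 := by
  refine Finset.sum_eq_zero fun m _ => if_neg ?_
  have := (w m).isLt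
  omega

lemma cornerCount_mul_swap {n : ℕ} (u : Equiv.Perm (Fin n)) {i j : Fin n} (hij : i < j)
    (k a : ℕ) :
    cornerCount (u * swap i j) k a = cornerCount u k a +
      if (i : ℕ) ≤ k ∧ k < (j : ℕ) then
        (if a ≤ (u j : ℕ) then 1 else 0) - (if a ≤ (u i : ℕ) then 1 else 0) else 0 := by
  have hij' : (i : ℕ) < j := hij
  have key : ∀ m : Fin n,
      (if (m : ℕ) ≤ k ∧ a ≤ ((u * swap i j) m : ℕ) then (1 : ℤ) else 0) =
      (if (m : ℕ) ≤ k ∧ a ≤ (u m : ℕ) then 1 else 0) +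
      ((if m = i then (if (i : ℕ) ≤ k then
          (if a ≤ (u j : ℕ) then 1 else 0) - (if a ≤ (u i : ℕ) then 1 else 0) else 0) else 0) +
       (if m = j then (if (j : ℕ) ≤ k then
          (if a ≤ (u i : ℕ) then 1 else 0) - (if a ≤ (u j : ℕ) then 1 else 0) else 0) else 0)) := by
    intro m
    by_cases hmi : m = i
    · subst hmi
      simp only [Equiv.Perm.mul_apply, swap_apply_left, hij.ne, if_true, if_false]
      split_ifs <;> omega
    · by_cases hmj : m = j
      · subst hmj
        simp only [Equiv.Perm.mul_apply, swap_apply_right, hmi, if_true, if_false]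
        split_ifs <;> omega
      · simp [Equiv.Perm.mul_apply, swap_apply_of_ne_of_ne hmi hmj, hmi, hmj]
  unfold cornerCount
  rw [Finset.sum_congr rfl fun m _ => key m, Finset.sum_add_distrib, Finset.sum_add_distrib,
    Finset.sum_ite_eq' Finset.univ i, Finset.sum_ite_eq' Finset.univ j]
  simp only [Finset.mem_univ, if_true]
  split_ifs <;> omega

lemma len_eq_sum (n : ℕ) (w : Equiv.Perm (Fin n)) :
    (len n w : ℤ) = ∑ x : Fin n, ∑ y : Fin n, if x < y ∧ w y < w x then 1 else 0 := by
  rw [← Fintype.sum_prod_type' (fun x y : Fin n => if x < y ∧ w y < w x then (1 : ℤ) else 0)]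
  simp [len]

/-- A double sum of a function supported on the cross `{x, y} ∩ {i, j} ≠ ∅`. -/
lemma sum_sum_eq_of_cross {α : Type*} [Fintype α] [DecidableEq α] (F : α → α → ℤ) {i j : α}
    (hij : i ≠ j) (hF : ∀ x y, x ≠ i → x ≠ j → y ≠ i → y ≠ j → F x y = 0) :
    ∑ x, ∑ y, F x y = ∑ m, (F i m + F j m + if m = i ∨ m = j then 0 else F m i + F m j) := by
  have key : ∀ x y, F x y = (if x = i then F i y else 0) + (if x = j then F j y else 0) +
      ((if y = i then (if x = i ∨ x = j then 0 else F x i) else 0) +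
       (if y = j then (if x = i ∨ x = j then 0 else F x j) else 0)) := by
    intro x y
    by_cases hxi : x = i
    · subst hxi; simp [hij]
    by_cases hxj : x = j
    · subst hxj; simp [hxi]
    by_cases hyi : y = i
    · subst hyi; simp [hij, hxi, hxj]
    by_cases hyj : y = j
    · subst hyj; simp [hyi, hxi, hxj]
    simp [hxi, hxj, hyi, hyj, hF x y hxi hxj hyi hyj]
  have hcol : ∑ x, ∑ y, F x y = ∑ x, ∑ y,
      ((if x = i then F i y else 0) + (if x = j then F j y else 0)) +
      ∑ x, (if x = i ∨ x = j then 0 else F x i + F x j) := by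
    rw [← Finset.sum_add_distrib]
    refine Finset.sum_congr rfl fun x _ => ?_
    rw [Finset.sum_congr rfl fun y _ => key x y, Finset.sum_add_distrib]
    congr 1
    rw [Finset.sum_add_distrib]
    simp only [Finset.sum_ite_eq', Finset.mem_univ, if_true]
    split_ifs <;> simp
  rw [hcol, Finset.sum_comm, Finset.sum_add_distrib]
  simp only [Finset.sum_add_distrib, Finset.sum_ite_eq', Finset.mem_univ, if_true]

lemma len_mul_swap (n : ℕ) (u : Equiv.Perm (Fin n)) {i j : Fin n} (hij : i < j)
    (hu : u i < u j) :
    len n (u * swap i j) = len n u + 1 +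
      2 * (Finset.univ.filter fun m => i < m ∧ m < j ∧ u i < u m ∧ u m < u j).card := by
  set σ := swap i j with hσ
  have hσσ : ∀ x, σ (σ x) = x := fun x => swap_apply_self i j x
  have reindex : (len n (u * σ) : ℤ) =
      ∑ x : Fin n, ∑ y : Fin n, if σ x < σ y ∧ u y < u x then 1 else 0 := by
    rw [len_eq_sum, ← Equiv.sum_comp σ]
    refine Finset.sum_congr rfl fun x _ => ?_
    rw [← Equiv.sum_comp σ]
    simp only [Equiv.Perm.mul_apply, hσσ]
  have diff : (len n (u * σ) : ℤ) - len n u = ∑ x : Fin n, ∑ y : Fin n,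
      ((if σ x < σ y ∧ u y < u x then (1 : ℤ) else 0) -
        if x < y ∧ u y < u x then 1 else 0) := by
    rw [reindex, len_eq_sum]
    simp only [Finset.sum_sub_distrib]
  have hσi : σ i = j := swap_apply_left i j
  have hσj : σ j = i := swap_apply_right i j
  have hσm : ∀ m, m ≠ i → m ≠ j → σ m = m := fun m => swap_apply_of_ne_of_ne
  rw [sum_sum_eq_of_cross _ hij.ne] at diff
  · have key : ∀ m : Fin n,
        ((if σ i < σ m ∧ u m < u i then (1 : ℤ) else 0) -
            (if i < m ∧ u m < u i then 1 else 0)) +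
          ((if σ j < σ m ∧ u m < u j then (1 : ℤ) else 0) -
            (if j < m ∧ u m < u j then 1 else 0)) +
          (if m = i ∨ m = j then 0 else
            ((if σ m < σ i ∧ u i < u m then (1 : ℤ) else 0) -
              (if m < i ∧ u i < u m then 1 else 0)) +
            ((if σ m < σ j ∧ u j < u m then (1 : ℤ) else 0) -
              (if m < j ∧ u j < u m then 1 else 0))) =
        (if m = i then 1 else 0) +
          2 * (if i < m ∧ m < j ∧ u i < u m ∧ u m < u j then 1 else 0) := by
      intro m
      have hiv : ∀ x, u x = u i → x = i := fun x h => u.injective h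
      have hjv : ∀ x, u x = u j → x = j := fun x h => u.injective h
      by_cases hmi : m = i
      · subst hmi
        simp [hσi, hσj, hij, hu, hij.asymm]
      · by_cases hmj : m = j
        · subst hmj
          simp [hσi, hσj, hmi, hu.asymm, hij.asymm]
        · rw [hσi, hσj, hσm m hmi hmj]
          have h1 : u m ≠ u i := fun h => hmi (hiv m h)
          have h2 : u m ≠ u j := fun h => hmj (hjv m h)
          simp only [hmi, hmj, or_self, if_false]
          rcases lt_or_gt_of_ne hmi with a | a <;> rcases lt_or_gt_of_ne hmj with b | b <;>
          rcases lt_or_gt_of_ne h1 with c | c <;> rcases lt_or_gt_of_ne h2 with d | d <;>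
          simp [a, b, c, d, a.asymm, b.asymm, c.asymm, d.asymm] <;> order
    rw [Finset.sum_congr rfl fun m _ => key m, Finset.sum_add_distrib,
      Finset.sum_ite_eq', ← Finset.mul_sum] at diff
    simp only [Finset.mem_univ, if_true, Finset.sum_boole] at diff
    omega
  · intro x y hxi hxj hyi hyj
    rw [hσm x hxi hxj, hσm y hyi hyj, sub_self]

lemma len_mul_swap_lt (n : ℕ) (u : Equiv.Perm (Fin n)) {i j : Fin n} (hij : i < j)
    (hu : u j < u i) :
    len n u = len n (u * swap i j) + 1 +
      2 * (Finset.univ.filter fun m => i < m ∧ m < j ∧ u j < u m ∧ u m < u i).card := by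
  have h := len_mul_swap n (u * swap i j) hij (by simpa using hu)
  rw [mul_assoc, swap_mul_self, mul_one] at h
  rw [h]
  congr 2
  refine congrArg Finset.card (Finset.filter_congr fun m _ => ?_)
  refine and_congr_right fun h1 => and_congr_right fun h2 => ?_
  simp [swap_apply_of_ne_of_ne h1.ne' h2.ne]

lemma sum_edgeWeight (n : ℕ) (u : Equiv.Perm (Fin n)) (p : Fin n × Fin n)
    (hp : isQBEdge n u p) :
    2 * ∑ k, edgeWeight n u p k = len n u + 1 - len n (step n u p) := by
  obtain ⟨hlt, h⟩ := hp
  have hlt' : (p.1 : ℕ) < p.2 := hlt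
  unfold edgeWeight
  split_ifs with hup
  · simp only [Pi.zero_apply, Finset.sum_const_zero]
    omega
  · have h := h.resolve_left hup
    have hsum : ∑ k : Fin (n - 1),
        (if (p.1 : ℕ) ≤ (k : ℕ) ∧ (k : ℕ) < (p.2 : ℕ) then (1 : ℤ) else 0) =
        ((p.2 : ℕ) - (p.1 : ℕ) : ℕ) := by
      rw [Fin.sum_univ_eq_sum_range
        (fun k => if (p.1 : ℕ) ≤ k ∧ k < (p.2 : ℕ) then (1 : ℤ) else 0), Finset.sum_boole,
        ← Nat.card_Ico (p.1 : ℕ) p.2]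
      refine congrArg (fun s : Finset ℕ => (s.card : ℤ)) (Finset.ext fun k => ?_)
      have := p.2.isLt
      simp only [Finset.mem_filter, Finset.mem_range, Finset.mem_Ico]
      omega
    rw [hsum]
    omega

lemma length_eq_of_isPath (n : ℕ) (v : Equiv.Perm (Fin n)) :
    ∀ (L : List (Fin n × Fin n)) (u : Equiv.Perm (Fin n)), isPath n u L v →
      (L.length : ℤ) = len n v - len n u + 2 * ∑ k, pathWeight n u L k
  | [], u, h => by
    have h : u = v := h
    simp [pathWeight, h]
  | p :: ps, u, h => by
    have ih := length_eq_of_isPath n v ps _ h.2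
    have he := sum_edgeWeight n u p h.1
    simp only [pathWeight, Pi.add_apply, Finset.sum_add_distrib, List.length_cons]
    push_cast
    linarith

lemma cornerCount_le_step (n : ℕ) (u : Equiv.Perm (Fin n)) (p : Fin n × Fin n)
    (hp : isQBEdge n u p) (k : Fin (n - 1)) (a : ℕ) :
    cornerCount u k a ≤ cornerCount (step n u p) k a + edgeWeight n u p k := by
  obtain ⟨hlt, -⟩ := hp
  unfold edgeWeight
  by_cases hup : len n (step n u p) = len n u + 1
  · have hlt' : u p.1 < u p.2 := by
      by_contra h
      have := len_mul_swap_lt n u hlt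
        (lt_of_le_of_ne (not_lt.mp h) fun h => hlt.ne' (u.injective h))
      unfold step at hup
      omega
    rw [Fin.lt_def] at hlt'
    rw [if_pos hup, Pi.zero_apply]
    unfold step
    rw [cornerCount_mul_swap u hlt]
    split_ifs <;> omega
  · rw [if_neg hup]
    unfold step
    rw [cornerCount_mul_swap u hlt]
    split_ifs <;> omega

lemma cornerCount_le_of_isPath (n : ℕ) (v : Equiv.Perm (Fin n)) (k : Fin (n - 1)) (a : ℕ) :
    ∀ (L : List (Fin n × Fin n)) (u : Equiv.Perm (Fin n)), isPath n u L v →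
      cornerCount u k a ≤ cornerCount v k a + pathWeight n u L k
  | [], u, h => by
    have h : u = v := h
    simp [pathWeight, h]
  | p :: ps, u, h => by
    have ih := cornerCount_le_of_isPath n v k a ps _ h.2
    have he := cornerCount_le_step n u p h.1 k a
    simp only [pathWeight, Pi.add_apply]
    linarith

/-- Membership of `x` in the cyclic interval `(a, b]`, where `a ≠ b`. -/
def InCyclicIoc (a b x : ℕ) : Prop :=
  if a < b then a < x ∧ x ≤ b else a < x ∨ x ≤ b

lemma cornerCount_sub_lt {n : ℕ} {u v : Equiv.Perm (Fin n)} {i : Fin n} (hi : u i ≠ v i)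
    (hlt : ∀ m < i, u m = v m) {k a : ℕ} (hik : (i : ℕ) ≤ k)
    (hk : ∀ m : Fin n, i < m → (m : ℕ) ≤ k → ¬ InCyclicIoc (u i) (v i) (u m))
    (ha : InCyclicIoc (u i) (v i) a) :
    cornerCount u k a + 1 - cornerCount u k ((v i : ℕ) + 1) ≤
      cornerCount v k a - cornerCount v k ((v i : ℕ) + 1) := by
  have hone : (1 : ℤ) = ∑ m : Fin n, if m = i then 1 else 0 := by simp
  have hi' : (u i : ℕ) ≠ v i := fun h => hi (Fin.ext h)
  rw [hone]
  unfold cornerCount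
  simp only [← Finset.sum_add_distrib, ← Finset.sum_sub_distrib]
  refine Finset.sum_le_sum fun m _ => ?_
  unfold InCyclicIoc at ha hk
  rcases lt_trichotomy m i with h | h | h
  · simp [hlt m h, h.ne]
  · subst h
    simp only [if_true, hik, true_and]
    split_ifs at ha ⊢ <;> omega
  · have hkm := hk m h
    rw [if_neg h.ne']
    split_ifs at ha hkm ⊢ <;> omega

lemma exists_edge (n : ℕ) {u v : Equiv.Perm (Fin n)} (huv : u ≠ v) {d : Fin (n - 1) → ℤ}
    (hd : ∀ k a, cornerCount u (k : Fin (n - 1)) a ≤ cornerCount v k a + d k) :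
    ∃ p, isQBEdge n u p ∧
      ∀ k a, cornerCount (step n u p) (k : Fin (n - 1)) a ≤
        cornerCount v k a + (d - edgeWeight n u p) k := by
  classical
  obtain ⟨i, hi, hmin⟩ : ∃ i, u i ≠ v i ∧ ∀ m < i, u m = v m := by
    have hne : (Finset.univ.filter fun i => u i ≠ v i).Nonempty := by
      by_contra h
      rw [Finset.not_nonempty_iff_eq_empty, Finset.filter_eq_empty_iff] at h
      exact huv (Equiv.ext fun x => not_not.mp (h (Finset.mem_univ x)))
    refine ⟨_, (Finset.mem_filter.mp (Finset.min'_mem _ hne)).2, fun m hm => ?_⟩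
    by_contra h
    exact (Finset.min'_le _ m (by simpa using h)).not_gt hm
  have hi' : (u i : ℕ) ≠ v i := fun h => hi (Fin.ext h)
  obtain ⟨j, hij, hj, hjmin⟩ : ∃ j, i < j ∧ InCyclicIoc (u i) (v i) (u j) ∧
      ∀ m, i < m → m < j → ¬ InCyclicIoc (u i) (v i) (u m) := by
    have hne : (Finset.univ.filter fun j => i < j ∧ InCyclicIoc (u i) (v i) (u j)).Nonempty := by
      refine ⟨u.symm (v i), ?_⟩
      simp only [Finset.mem_filter, Finset.mem_univ, true_and, Equiv.apply_symm_apply]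
      constructor
      · by_contra h
        rcases (not_lt.mp h).lt_or_eq with h | h
        · have h2 := hmin _ h
          rw [Equiv.apply_symm_apply] at h2
          exact h.ne (v.injective h2).symm
        · rw [Equiv.symm_apply_eq] at h
          exact hi h.symm
      · unfold InCyclicIoc
        split_ifs <;> omega
    have hmem := (Finset.mem_filter.mp (Finset.min'_mem _ hne)).2
    refine ⟨_, hmem.1, hmem.2, fun m him hm h => ?_⟩
    exact (Finset.min'_le _ m (by simp [him, h])).not_gt hm
  have hij' : (i : ℕ) < j := hij
  have tight : ∀ (k : Fin (n - 1)) (a : ℕ), (i : ℕ) ≤ k → (k : ℕ) < j →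
      InCyclicIoc (u i) (v i) a → cornerCount u k a + 1 ≤ cornerCount v k a + d k := by
    intro k a hik hkj ha
    have h1 := cornerCount_sub_lt hi hmin hik
      (fun m him hm => hjmin m him (Fin.lt_def.mpr (by omega))) ha
    have h2 := hd k ((v i : ℕ) + 1)
    linarith
  refine ⟨(i, j), ?_⟩
  rcases lt_or_ge (u i) (u j) with hup | hdown
  · have hlen : len n (step n u (i, j)) = len n u + 1 := by
      unfold step
      rw [len_mul_swap n u hij hup, Finset.filter_eq_empty_iff.mpr, Finset.card_empty]
      rintro m - ⟨h1, h2, h3, h4⟩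
      refine hjmin m h1 h2 ?_
      rw [Fin.lt_def] at h3 h4
      unfold InCyclicIoc at hj ⊢
      split_ifs at hj ⊢ <;> omega
    refine ⟨⟨hij, Or.inl hlen⟩, fun k a => ?_⟩
    have hka := hd k a
    have ht := tight k a
    rw [Fin.lt_def] at hup
    unfold edgeWeight
    rw [if_pos hlen, sub_zero]
    unfold step
    rw [cornerCount_mul_swap u hij]
    unfold InCyclicIoc at hj ht
    split_ifs at hj ht ⊢ <;> omega
  · have hdown : u j < u i := lt_of_le_of_ne hdown fun h => hij.ne' (u.injective h)
    have hcard : (Finset.univ.filter fun m => i < m ∧ m < j ∧ u j < u m ∧ u m < u i) =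
        Finset.Ioo i j := by
      ext m
      simp only [Finset.mem_filter, Finset.mem_univ, true_and, Finset.mem_Ioo]
      refine ⟨fun h => ⟨h.1, h.2.1⟩, fun h => ⟨h.1, h.2, ?_⟩⟩
      have h1 := hjmin m h.1 h.2
      have h2 : (u m : ℕ) ≠ u i := fun e => h.1.ne' (u.injective (Fin.ext e))
      rw [Fin.lt_def] at hdown ⊢
      rw [Fin.lt_def]
      unfold InCyclicIoc at hj h1
      split_ifs at hj h1 <;> omega
    have hlen : len n (step n u (i, j)) + 2 * ((j : ℕ) - (i : ℕ)) = len n u + 1 := by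
      have := len_mul_swap_lt n u hij hdown
      rw [hcard, Fin.card_Ioo] at this
      unfold step
      dsimp only
      omega
    have hnup : ¬ len n (step n u (i, j)) = len n u + 1 := by omega
    refine ⟨⟨hij, Or.inr hlen⟩, fun k a => ?_⟩
    have hka := hd k a
    have ht := tight k a
    rw [Fin.lt_def] at hdown
    unfold edgeWeight
    rw [if_neg hnup, Pi.sub_apply]
    unfold step
    rw [cornerCount_mul_swap u hij]
    unfold InCyclicIoc at hj ht
    dsimp only
    split_ifs at hj ht ⊢ <;> omega

lemma exists_path_of_bound (n : ℕ) (v : Equiv.Perm (Fin n)) (N : ℕ) :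
    ∀ (u : Equiv.Perm (Fin n)) (d : Fin (n - 1) → ℤ),
      (∀ k a, cornerCount u (k : Fin (n - 1)) a ≤ cornerCount v k a + d k) →
      (n * n : ℤ) - len n u + 2 * ∑ k, d k < N →
      ∃ L, isPath n u L v ∧ ∀ k, pathWeight n u L k ≤ d k := by
  have nonneg : ∀ (u : Equiv.Perm (Fin n)) (d : Fin (n - 1) → ℤ),
      (∀ k a, cornerCount u (k : Fin (n - 1)) a ≤ cornerCount v k a + d k) → ∀ k, 0 ≤ d k := by
    intro u d hd k
    have := hd k n
    rw [cornerCount_eq_zero, cornerCount_eq_zero] at this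
    linarith
  induction N with
  | zero =>
    intro u d hd hN
    have h1 : (0 : ℤ) ≤ ∑ k, d k := Finset.sum_nonneg fun k _ => nonneg u d hd k
    have h2 : len n u ≤ n * n := by
      refine (Finset.card_le_univ _).trans ?_
      simp
    zify at h2
    push_cast at hN
    linarith
  | succ N ih =>
    intro u d hd hN
    by_cases huv : u = v
    · exact ⟨[], huv, nonneg u d hd⟩
    · obtain ⟨p, hp, hpd⟩ := exists_edge n huv hd
      have hw := sum_edgeWeight n u p hp
      obtain ⟨L, hL, hLd⟩ := ih (step n u p) (d - edgeWeight n u p) hpd (by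
        simp only [Pi.sub_apply, Finset.sum_sub_distrib]
        push_cast at hN
        linarith)
      refine ⟨p :: L, ⟨hp, hL⟩, fun k => ?_⟩
      have := hLd k
      simp only [pathWeight, Pi.add_apply, Pi.sub_apply] at this ⊢
      linarith

/-- All shortest directed paths from `u` to `v` in the quantum Bruhat graph `Γ_n`
have the same weight. -/
theorem shortest_paths_same_weight (n : ℕ) (hn : 2 ≤ n) (u v : Equiv.Perm (Fin n))
    (L₁ L₂ : List (Fin n × Fin n))
    (h₁ : isPath n u L₁ v) (h₂ : isPath n u L₂ v)
    (hmin₁ : ∀ L : List (Fin n × Fin n), isPath n u L v → L₁.length ≤ L.length)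
    (hmin₂ : ∀ L : List (Fin n × Fin n), isPath n u L v → L₂.length ≤ L.length) :
    pathWeight n u L₁ = pathWeight n u L₂ := by
  obtain ⟨L, hL, hLd⟩ := exists_path_of_bound n v
    ((n * n : ℤ) - len n u +
      2 * ∑ k, min (pathWeight n u L₁ k) (pathWeight n u L₂ k) + 1).toNat u
    (fun k => min (pathWeight n u L₁ k) (pathWeight n u L₂ k))
    (fun k a => by
      rw [← min_add_add_left]
      exact le_min (cornerCount_le_of_isPath n v k a L₁ u h₁)
        (cornerCount_le_of_isPath n v k a L₂ u h₂))
    (by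
      have := Int.self_le_toNat ((n * n : ℤ) - len n u +
        2 * ∑ k, min (pathWeight n u L₁ k) (pathWeight n u L₂ k) + 1)
      linarith)
  have agree : ∀ M, isPath n u M v → (M.length ≤ L.length) →
      (∀ k, pathWeight n u L k ≤ pathWeight n u M k) → pathWeight n u L = pathWeight n u M := by
    intro M hM hle hk
    have e1 := length_eq_of_isPath n v L u hL
    have e2 := length_eq_of_isPath n v M u hM
    have hsum := Finset.sum_le_sum fun k (_ : k ∈ Finset.univ) => hk k
    have heq : ∑ k, pathWeight n u L k = ∑ k, pathWeight n u M k := by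
      zify at hle
      linarith
    funext k
    exact (Finset.sum_eq_sum_iff_of_le fun k _ => hk k).mp heq k (Finset.mem_univ k)
  rw [← agree L₁ h₁ (hmin₁ L hL) fun k => (hLd k).trans (min_le_left _ _),
    ← agree L₂ h₂ (hmin₂ L hL) fun k => (hLd k).trans (min_le_right _ _)]
end

section
/- Let a, b, b', c ∈ S_n with a ≠ c and b ≠ b', and suppose that a → b → c and a → b' → c are both directed paths of length 2 in the quantum Bruhat graph Γ_n. Then the two paths have the same weight: weight(a→b) + weight(b→c) = weight(a→b') + weight(b'→c) in ℤ^{n−1}. -/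
open Equiv

section Length

variable {n : ℕ}

theorem len_cast_eq_sum (w : Equiv.Perm (Fin n)) :
    (len n w : ℤ) = ∑ p : Fin n, ∑ q : Fin n, if p < q ∧ w q < w p then 1 else 0 := by
  rw [len, Finset.card_filter, Fintype.sum_prod_type]
  push_cast
  rfl

theorem len_mul_swap_cast_eq_sum (u : Equiv.Perm (Fin n)) (i j : Fin n) :
    (len n (u * swap i j) : ℤ) =
      ∑ p : Fin n, ∑ q : Fin n, if swap i j p < swap i j q ∧ u q < u p then 1 else 0 := by
  rw [len_cast_eq_sum, ← Equiv.sum_comp (swap i j)]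
  refine Finset.sum_congr rfl fun p _ => ?_
  rw [← Equiv.sum_comp (swap i j)]
  simp

/-- The positions strictly between `i` and `j` whose values under `u` lie strictly between
`u i` and `u j`. -/
def nested (u : Equiv.Perm (Fin n)) (i j : Fin n) : Finset (Fin n) :=
  (Finset.Ioo i j).filter fun m => u i < u m ∧ u m < u j

theorem len_mul_swap_of_lt (u : Equiv.Perm (Fin n)) {i j : Fin n} (hij : i < j)
    (hu : u i < u j) : len n (u * swap i j) = len n u + 1 + 2 * (nested u i j).card := by
  have inv_diff : ∀ p q : Fin n,
      (if swap i j p < swap i j q ∧ u q < u p then 1 else 0 : ℤ) =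
        (if p < q ∧ u q < u p then 1 else 0)
        + (if p = j then (if q = i then 1 else 0) else 0)
        - (if p = i then (if (i < q ∧ q < j) ∧ u q < u i then 1 else 0) else 0)
        + (if q = i then (if (i < p ∧ p < j) ∧ u i < u p then 1 else 0) else 0)
        - (if q = j then (if (i < p ∧ p < j) ∧ u j < u p then 1 else 0) else 0)
        + (if p = j then (if (i < q ∧ q < j) ∧ u q < u j then 1 else 0) else 0) := by
    intro p q
    rw [swap_apply_def, swap_apply_def]
    grind
  have nested_indicator : ∀ m : Fin n,
      (if (i < m ∧ m < j) ∧ u i < u m then 1 else 0 : ℤ)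
        - (if (i < m ∧ m < j) ∧ u m < u i then 1 else 0)
        - (if (i < m ∧ m < j) ∧ u j < u m then 1 else 0)
        + (if (i < m ∧ m < j) ∧ u m < u j then 1 else 0)
      = 2 * (if (i < m ∧ m < j) ∧ u i < u m ∧ u m < u j then 1 else 0) := by
    intro m
    have hi : m ≠ i → u m ≠ u i := fun h e => h (u.injective e)
    have hj : m ≠ j → u m ≠ u j := fun h e => h (u.injective e)
    grind
  have card_nested : ((nested u i j).card : ℤ) =
      ∑ m : Fin n, if (i < m ∧ m < j) ∧ u i < u m ∧ u m < u j then 1 else 0 := by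
    rw [nested, ← Finset.filter_univ_mem (Finset.Ioo i j), Finset.filter_filter,
      Finset.card_filter]
    simp only [Finset.mem_Ioo]
    push_cast
    rfl
  zify
  rw [len_mul_swap_cast_eq_sum, len_cast_eq_sum, card_nested, Finset.mul_sum]
  have inner_const : ∀ (r : Fin n) (f : Fin n → ℤ),
      (∑ p : Fin n, ∑ q : Fin n, if p = r then f q else 0) = ∑ q, f q := by
    intro r f
    rw [Finset.sum_comm]
    simp
  simp_rw [inv_diff, ← nested_indicator, Finset.sum_add_distrib, Finset.sum_sub_distrib,
    Finset.sum_add_distrib, Finset.sum_sub_distrib, Finset.sum_add_distrib, inner_const]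
  simp only [Finset.sum_ite_eq', Finset.mem_univ, if_true]
  ring

/-- An edge labeled `p` either increases the value at the smaller position and has weight `0`, with
no value in between, or decreases it and has weight the root of `p`, with all values in between. -/
theorem isQBEdge.value_condition {u : Equiv.Perm (Fin n)} {p : Fin n × Fin n}
    (h : isQBEdge n u p) :
    (u p.1 < u p.2 ∧ (∀ m, p.1 < m → m < p.2 → ¬(u p.1 < u m ∧ u m < u p.2)) ∧
      edgeWeight n u p = 0) ∨
    (u p.2 < u p.1 ∧ (∀ m, p.1 < m → m < p.2 → u p.2 < u m ∧ u m < u p.1) ∧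
      edgeWeight n u p = fun k : Fin (n - 1) =>
        (if (p.1 : ℕ) ≤ (k : ℕ) ∧ (k : ℕ) < (p.2 : ℕ) then 1 else 0 : ℤ)) := by
  obtain ⟨i, j⟩ := p
  obtain ⟨hij, h⟩ := h
  simp only [step, edgeWeight] at *
  have hij' : (i : ℕ) < j := hij
  rcases lt_or_gt_of_ne (u.injective.ne hij.ne) with hu | hu
  · left
    have hlen := len_mul_swap_of_lt u hij hu
    have hup : len n (u * swap i j) = len n u + 1 := by omega
    have hempty : nested u i j = ∅ := Finset.card_eq_zero.mp (by omega)
    refine ⟨hu, fun m him hmj hm => ?_, if_pos hup⟩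
    have : m ∈ nested u i j := by simp [nested, *]
    simp [hempty] at this
  · right
    have hlen := len_mul_swap_of_lt (u * swap i j) hij (by simpa using hu)
    rw [mul_assoc, swap_mul_self, mul_one] at hlen
    have hdown : ¬ len n (u * swap i j) = len n u + 1 := by omega
    have hfull : nested (u * swap i j) i j = Finset.Ioo i j := by
      refine Finset.eq_of_subset_of_card_le (Finset.filter_subset _ _) ?_
      rw [Fin.card_Ioo]
      omega
    refine ⟨hu, fun m him hmj => ?_, if_neg hdown⟩
    have : m ∈ nested (u * swap i j) i j := by simp [*]
    have hm : swap i j m = m := swap_apply_of_ne_of_ne him.ne' hmj.ne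
    simpa [nested, hm, him, hmj] using this

theorem isQBEdge.edgeWeight_apply {u : Equiv.Perm (Fin n)} {p : Fin n × Fin n}
    (h : isQBEdge n u p) (t : Fin (n - 1)) : edgeWeight n u p t =
      if u p.2 < u p.1 then (if (p.1 : ℕ) ≤ (t : ℕ) ∧ (t : ℕ) < (p.2 : ℕ) then 1 else 0) else 0 := by
  rcases isQBEdge.value_condition h with ⟨hu, -, hw⟩ | ⟨hu, -, hw⟩
  · rw [hw, if_neg hu.not_gt, Pi.zero_apply]
  · rw [hw, if_pos hu]

theorem isQBEdge.middle_value {u : Equiv.Perm (Fin n)} {p : Fin n × Fin n}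
    (h : isQBEdge n u p) (m : Fin n) : p.1 < m → m < p.2 →
      (u p.1 < u p.2 ∧ ¬(u p.1 < u m ∧ u m < u p.2)) ∨ (u p.2 < u m ∧ u m < u p.1) := fun hl hr =>
  (isQBEdge.value_condition h).imp (fun e => ⟨e.1, e.2.1 m hl hr⟩) (fun e => e.2.1 m hl hr)

end Length

section SwapProducts

variable {α : Type*} [LinearOrder α]

theorem mem_of_swap_mul_swap_eq {i j k l i' j' k' l' : α} (hij : i' ≠ j') (hkl : k' ≠ l')
    (h : swap i j * swap k l = swap i' j' * swap k' l') (h1 : swap i j * swap k l ≠ 1)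
    {x : α} (hx : x = i' ∨ x = j' ∨ x = k' ∨ x = l') : x = i ∨ x = j ∨ x = k ∨ x = l := by
  by_contra! hne
  have hfix : swap i' j' (swap k' l' x) = x := by
    rw [← Perm.mul_apply, ← h, Perm.mul_apply, swap_apply_of_ne_of_ne hne.2.2.1 hne.2.2.2,
      swap_apply_of_ne_of_ne hne.1 hne.2.1]
  have hpair : (i' = k' ∧ j' = l') ∨ (i' = l' ∧ j' = k') := by
    simp only [swap_apply_def] at hfix
    grind
  apply h1
  rw [h]
  rcases hpair with ⟨rfl, rfl⟩ | ⟨rfl, rfl⟩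
  · exact swap_mul_self _ _
  · rw [swap_comm, swap_mul_self]

/-- A product of two transpositions of three points `x < y < z` is trivial or one of the two
3-cycles, each of which has three factorizations. -/
theorem swap_mul_swap_three_points {x y z i j k l : α} (hxy : x < y) (hyz : y < z)
    (hij : i < j) (hkl : k < l) (hi : i = x ∨ i = y ∨ i = z) (hj : j = x ∨ j = y ∨ j = z)
    (hk : k = x ∨ k = y ∨ k = z) (hl : l = x ∨ l = y ∨ l = z) :
    swap i j * swap k l = 1 ∨
    (((i, j), (k, l)) ∈ [((x, y), (y, z)), ((y, z), (x, z)), ((x, z), (x, y))] ∧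
      (swap i j * swap k l) x = y) ∨
    (((i, j), (k, l)) ∈ [((y, z), (x, y)), ((x, y), (x, z)), ((x, z), (y, z))] ∧
      (swap i j * swap k l) x = z) := by
  have pair_cases : ∀ r s : α, r < s → (r = x ∨ r = y ∨ r = z) → (s = x ∨ s = y ∨ s = z) →
      (r = x ∧ s = y) ∨ (r = x ∧ s = z) ∨ (r = y ∧ s = z) := by
    intro r s
    grind
  rcases pair_cases i j hij hi hj with ⟨rfl, rfl⟩ | ⟨rfl, rfl⟩ | ⟨rfl, rfl⟩ <;>
  rcases pair_cases k l hkl hk hl with ⟨h, h'⟩ | ⟨h, h'⟩ | ⟨h, h'⟩ <;>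
  subst h h' <;>
  simp [swap_apply_def, hij.ne, hij.ne', hkl.ne, hkl.ne', hxy.ne, hxy.ne', hyz.ne, hyz.ne',
    (hxy.trans hyz).ne]

/-- Two distinct factorizations of a nontrivial permutation into disjoint transpositions differ
only in the order of the factors. -/
theorem swap_mul_swap_eq_of_disjoint {i j k l i' j' k' l' : α} (hij : i < j) (hkl : k < l)
    (hij' : i' < j') (hkl' : k' < l') (h : swap i j * swap k l = swap i' j' * swap k' l')
    (hne : (i, j) ≠ (i', j')) (hik : i ≠ k) (hil : i ≠ l) (hjk : j ≠ k) (hjl : j ≠ l) :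
    (i', j') = (k, l) ∧ (k', l') = (i, j) := by
  have happ : ∀ x, swap i j (swap k l x) = swap i' j' (swap k' l' x) := fun x => by
    simpa using congrArg (fun σ : Equiv.Perm α => σ x) h
  have ei := happ i
  have ej := happ j
  have ek := happ k
  have el := happ l
  simp only [swap_apply_of_ne_of_ne hik hil, swap_apply_of_ne_of_ne hjk hjl,
    swap_apply_of_ne_of_ne hik.symm hjk.symm, swap_apply_of_ne_of_ne hil.symm hjl.symm,
    swap_apply_left, swap_apply_right] at ei ej ek el
  simp only [Prod.mk.injEq] at *
  simp only [swap_apply_def] at ei ej ek el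
  clear happ h
  grind (splits := 30)

/-- Classification of the pairs of distinct factorizations of a nontrivial permutation into two
transpositions: the transpositions commute, or the permutation is one of the two 3-cycles
on three points `x < y < z`. -/
theorem swap_mul_swap_eq_cases {i j k l i' j' k' l' : α} (hij : i < j) (hkl : k < l)
    (hij' : i' < j') (hkl' : k' < l') (h : swap i j * swap k l = swap i' j' * swap k' l')
    (h1 : swap i j * swap k l ≠ 1) (hne : (i, j) ≠ (i', j')) :
    (((i', j') = (k, l) ∧ (k', l') = (i, j)) ∧ i ≠ k ∧ i ≠ l ∧ j ≠ k ∧ j ≠ l) ∨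
    ∃ x y z, x < y ∧ y < z ∧
      ((((i, j), (k, l)) ∈ [((x, y), (y, z)), ((y, z), (x, z)), ((x, z), (x, y))] ∧
        ((i', j'), (k', l')) ∈ [((x, y), (y, z)), ((y, z), (x, z)), ((x, z), (x, y))]) ∨
       (((i, j), (k, l)) ∈ [((y, z), (x, y)), ((x, y), (x, z)), ((x, z), (y, z))] ∧
        ((i', j'), (k', l')) ∈ [((y, z), (x, y)), ((x, y), (x, z)), ((x, z), (y, z))])) := by
  by_cases hdisj : i ≠ k ∧ i ≠ l ∧ j ≠ k ∧ j ≠ l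
  · obtain ⟨hik, hil, hjk, hjl⟩ := hdisj
    exact .inl ⟨swap_mul_swap_eq_of_disjoint hij hkl hij' hkl' h hne hik hil hjk hjl,
      hik, hil, hjk, hjl⟩
  right
  have hpair : ¬(i = k ∧ j = l) := by
    rintro ⟨rfl, rfl⟩
    exact h1 (swap_mul_self _ _)
  obtain ⟨x, y, z, hxy, hyz, hxyz⟩ : ∃ x y z, x < y ∧ y < z ∧
      ∀ r, r = i ∨ r = j ∨ r = k ∨ r = l → r = x ∨ r = y ∨ r = z := by
    have hshare : i = k ∨ i = l ∨ j = k ∨ j = l := by tauto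
    clear h h1 hdisj hne
    rcases hshare with rfl | rfl | rfl | rfl
    · rcases lt_or_gt_of_ne (fun e => hpair ⟨rfl, e⟩ : j ≠ l) with hjl | hjl
      · exact ⟨i, j, l, hij, hjl, by tauto⟩
      · exact ⟨i, l, j, hkl, hjl, by tauto⟩
    · exact ⟨k, i, j, hkl, hij, by tauto⟩
    · exact ⟨i, j, l, hij, hkl, by tauto⟩
    · rcases lt_or_gt_of_ne (fun e => hpair ⟨e, rfl⟩ : i ≠ k) with hik | hik
      · exact ⟨i, k, j, hik, hkl, by tauto⟩
      · exact ⟨k, i, j, hik, hij, by tauto⟩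
  have hmem : ∀ r, r = i' ∨ r = j' ∨ r = k' ∨ r = l' → r = x ∨ r = y ∨ r = z := fun r hr =>
    hxyz r (mem_of_swap_mul_swap_eq hij'.ne hkl'.ne h h1 hr)
  have hfac := swap_mul_swap_three_points hxy hyz hij hkl (hxyz i (by simp)) (hxyz j (by simp))
    (hxyz k (by simp)) (hxyz l (by simp))
  have hfac' := swap_mul_swap_three_points hxy hyz hij' hkl' (hmem i' (by simp))
    (hmem j' (by simp)) (hmem k' (by simp)) (hmem l' (by simp))
  rw [← h] at hfac'
  refine ⟨x, y, z, hxy, hyz, ?_⟩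
  rcases hfac.resolve_left h1 with ⟨hm, hv⟩ | ⟨hm, hv⟩ <;>
  rcases hfac'.resolve_left h1 with ⟨hm', hv'⟩ | ⟨hm', hv'⟩
  · exact .inl ⟨hm, hm'⟩
  · exact absurd (hv.symm.trans hv') hyz.ne
  · exact absurd (hv.symm.trans hv') hyz.ne'
  · exact .inr ⟨hm, hm'⟩

end SwapProducts

/-- If `a → b → c` and `a → b' → c` are two directed paths of length 2 in the quantum
Bruhat graph `Γ_n` with `a ≠ c` and `b ≠ b'`, then they have the same weight. -/
theorem length_two_paths_same_weight (n : ℕ) (hn : 2 ≤ n)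
    (a b b' c : Equiv.Perm (Fin n)) (hac : a ≠ c) (hbb' : b ≠ b')
    (p₁ p₂ p₁' p₂' : Fin n × Fin n)
    (h₁ : isQBEdge n a p₁) (hb : step n a p₁ = b)
    (h₂ : isQBEdge n b p₂) (hc : step n b p₂ = c)
    (h₁' : isQBEdge n a p₁') (hb' : step n a p₁' = b')
    (h₂' : isQBEdge n b' p₂') (hc' : step n b' p₂' = c) :
    edgeWeight n a p₁ + edgeWeight n b p₂ = edgeWeight n a p₁' + edgeWeight n b' p₂' := by
  subst hb hb' hc
  obtain ⟨i, j⟩ := p₁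
  obtain ⟨k, l⟩ := p₂
  obtain ⟨i', j'⟩ := p₁'
  obtain ⟨k', l'⟩ := p₂'
  have hprod : swap i j * swap k l = swap i' j' * swap k' l' := by
    simpa [step, mul_assoc] using hc'.symm
  have hnontriv : swap i j * swap k l ≠ 1 := fun h => hac (by simp [step, mul_assoc, h])
  have hfirst : (i, j) ≠ (i', j') := fun h => hbb' (by rw [h])
  have hcases := swap_mul_swap_eq_cases h₁.1 h₂.1 h₁'.1 h₂'.1 hprod hnontriv hfirst
  funext t
  simp only [Pi.add_apply, isQBEdge.edgeWeight_apply h₁, isQBEdge.edgeWeight_apply h₂,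
    isQBEdge.edgeWeight_apply h₁', isQBEdge.edgeWeight_apply h₂']
  have mid₁ := isQBEdge.middle_value h₁
  have mid₂ := isQBEdge.middle_value h₂
  have mid₁' := isQBEdge.middle_value h₁'
  have mid₂' := isQBEdge.middle_value h₂'
  clear hc' h₁ h₂ h₁' h₂' hac hbb' hprod hnontriv hfirst
  simp only [step, Perm.mul_apply] at mid₁ mid₂ mid₁' mid₂' ⊢
  rcases hcases with ⟨⟨hp, hq⟩, hik, hil, hjk, hjl⟩ | ⟨x, y, z, hxy, hyz, hcyc⟩
  · simp only [Prod.mk.injEq] at hp hq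
    obtain ⟨rfl, rfl⟩ := hp
    obtain ⟨rfl, rfl⟩ := hq
    simp only [swap_apply_of_ne_of_ne, ne_eq, hik, hil, hjk, hjl, Ne.symm hik, Ne.symm hil,
      Ne.symm hjk, Ne.symm hjl, not_false_eq_true]
    exact add_comm _ _
  · have hxz := hxy.trans hyz
    obtain ⟨hsz, hsy, hsx⟩ : swap x y z = z ∧ swap x z y = y ∧ swap y z x = x :=
      ⟨swap_apply_of_ne_of_ne hxz.ne' hyz.ne', swap_apply_of_ne_of_ne hxy.ne' hyz.ne,
        swap_apply_of_ne_of_ne hxy.ne hxz.ne⟩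
    have root_add : (if (x : ℕ) ≤ (t : ℕ) ∧ (t : ℕ) < (z : ℕ) then 1 else 0 : ℤ) =
        (if (x : ℕ) ≤ (t : ℕ) ∧ (t : ℕ) < (y : ℕ) then 1 else 0) +
        (if (y : ℕ) ≤ (t : ℕ) ∧ (t : ℕ) < (z : ℕ) then 1 else 0) := by
      have : (x : ℕ) < y := hxy
      have : (y : ℕ) < z := hyz
      grind
    have axy := a.injective.ne hxy.ne
    have ayz := a.injective.ne hyz.ne
    have axz := a.injective.ne hxz.ne
    specialize mid₁ y
    specialize mid₂ y
    specialize mid₁' y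
    specialize mid₂' y
    simp only [List.mem_cons, List.not_mem_nil, Prod.mk.injEq, or_false] at hcyc
    rcases hcyc with ⟨h, h'⟩ | ⟨h, h'⟩ <;>
    rcases h with ⟨⟨rfl, rfl⟩, rfl, rfl⟩ | ⟨⟨rfl, rfl⟩, rfl, rfl⟩ | ⟨⟨rfl, rfl⟩, rfl, rfl⟩ <;>
    rcases h' with ⟨⟨rfl, rfl⟩, rfl, rfl⟩ | ⟨⟨rfl, rfl⟩, rfl, rfl⟩ | ⟨⟨rfl, rfl⟩, rfl, rfl⟩ <;>
    simp only [swap_apply_left, swap_apply_right, hsz, hsy, hsx, hxy, hyz, lt_irrefl, root_add,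
      false_imp_iff, true_imp_iff, imp_true_iff] at mid₁ mid₂ mid₁' mid₂' ⊢ <;>
    clear root_add <;>
    grind
end
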